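/- Let K be an invertible symmetric positive-definite n×n matrix with nonnegative integer entries and let (Q^(k), a^(k), b^(k)), k = 0, …, L−1, be a Durfee system for K. Then for every p ∈ ℤ^n the following identity holds in the ring of formal power series ℤ[[q]]: (∏_{j≥1}(1−q^j))^{−n} = Σ_{k=0}^{L−1} Σ_{(m,N̄)} q^{(m + a^(k))·(N̄ + b^(k))} / ∏_i (q;q)_{m_i} (q;q)_{N̄_i}, where the inner sum is over all pairs m, N̄ ∈ (ℤ≥0)^n with N̄ − K·m = Q^(k) + p; positive definiteness of K guarantees that only finitely many terms contribute to each power of q. -/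

import Mathlib

open Matrix

noncomputable section

/-- The field of rational functions `ℚ(q, z₁, …, z_n)`; the variable indexed by `none`
plays the role of `q` and the variable indexed by `some i` plays the role of `z i`. -/
abbrev FF (n : ℕ) := FractionRing (MvPolynomial (Option (Fin n)) ℚ)

/-- The indeterminate `q`. -/
def qv (n : ℕ) : FF n :=
  algebraMap (MvPolynomial (Option (Fin n)) ℚ) (FF n) (MvPolynomial.X (none : Option (Fin n)))

/-- The indeterminates `z i`. -/
def zv (n : ℕ) (i : Fin n) : FF n :=
  algebraMap (MvPolynomial (Option (Fin n)) ℚ) (FF n) (MvPolynomial.X (some i))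

/-- The q-Pochhammer symbol `(z; q)_M = ∏_{k=1}^M (1 - z q^{k-1})`. -/
def qPoch {F : Type*} [CommRing F] (q z : F) (M : ℕ) : F :=
  ∏ k ∈ Finset.range M, (1 - z * q ^ k)

/-- The q-binomial `[x choose y]_q = (q;q)_x / ((q;q)_y (q;q)_{x-y})` for `0 ≤ y ≤ x`,
and `0` otherwise. -/
def qBinom {F : Type*} [Field F] (q : F) (x y : ℤ) : F :=
  if 0 ≤ y ∧ y ≤ x then qPoch q q x.toNat / (qPoch q q y.toNat * qPoch q q (x - y).toNat)
  else 0

/-- A Durfee system of length `L` for the `n × n` matrix `K`:  a family of triples of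
vectors `(Q k, a k, b k) ∈ ((ℤ≥0)^n)³`, `k = 0, …, L-1`, such that for every
`M ∈ (ℤ≥0)^n` one has, as rational functions in `q, z₁, …, z_n`,
`1/∏_i (z_i q; q)_{M_i} = Σ_k Σ_{m ∈ (ℤ≥0)^n} (∏_i z_i^{m_i + a_i}) q^{(m+a)·(N+b)}
  (1/∏_i (z_i q;q)_{N_i}) ∏_i [M_i + m_i - N_i - b_i choose m_i]_q`
with `N := K·m + Q k`.  (The inner sum, a priori over all of `(ℤ≥0)^n`, has finite
support since the q-binomial factors vanish unless `N_i + b_i ≤ M_i`.) -/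
def IsDurfeeSystem {n L : ℕ} (K : Matrix (Fin n) (Fin n) ℕ)
    (Q a b : Fin L → Fin n → ℕ) : Prop :=
  ∀ M : Fin n → ℕ,
    (∏ i, qPoch (qv n) (zv n i * qv n) (M i))⁻¹ =
      ∑ k : Fin L, ∑ᶠ m : Fin n → ℕ,
        (∏ i, zv n i ^ (m i + a k i)) *
        qv n ^ (∑ i, (m i + a k i) * (K.mulVec m i + Q k i + b k i)) *
        (∏ i, qPoch (qv n) (zv n i * qv n) (K.mulVec m i + Q k i))⁻¹ *
        ∏ i, qBinom (qv n) ((M i : ℤ) + m i - (K.mulVec m i + Q k i : ℕ) - b k i) (m i)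

/-- The product (coefficient-wise) topology on `ℤ[[q]]`. -/
instance : TopologicalSpace (PowerSeries ℤ) :=
  inferInstanceAs (TopologicalSpace ((Unit →₀ ℕ) → ℤ))

theorem qPoch_add {F : Type*} [CommRing F] (q z : F) (r s : ℕ) :
    qPoch q z (r + s) = qPoch q z r * qPoch q (z * q ^ r) s := by
  simp only [qPoch, Finset.prod_range_add, pow_add, mul_assoc]

theorem qPoch_succ {F : Type*} [CommRing F] (q z : F) (r : ℕ) :
    qPoch q z (r + 1) = qPoch q z r * (1 - z * q ^ r) :=
  Finset.prod_range_succ _ _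

theorem map_qPoch {F G : Type*} [CommRing F] [CommRing G] (φ : F →+* G) (q z : F) (r : ℕ) :
    φ (qPoch q z r) = qPoch (φ q) (φ z) r := by
  simp [qPoch]

/-- The Gaussian polynomial `[r + s choose r]_q`, defined by its Pascal recursion over an
arbitrary commutative ring. -/
def gaussPoly {F : Type*} [CommRing F] (q : F) : ℕ → ℕ → F
  | 0, _ => 1
  | _ + 1, 0 => 1
  | r + 1, s + 1 => gaussPoly q r (s + 1) + q ^ (r + 1) * gaussPoly q (r + 1) s

theorem map_gaussPoly {F G : Type*} [CommRing F] [CommRing G] (φ : F →+* G) (q : F) (r s : ℕ) :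
    φ (gaussPoly q r s) = gaussPoly (φ q) r s := by
  fun_induction gaussPoly q r s <;> simp_all [gaussPoly]

theorem gaussPoly_mul_qPoch {F : Type*} [CommRing F] (q : F) (r s : ℕ) :
    gaussPoly q r s * (qPoch q q r * qPoch q q s) = qPoch q q (r + s) := by
  fun_induction gaussPoly q r s with
  | case1 s => simp [qPoch]
  | case2 r => simp [qPoch]
  | case3 r s ih₁ ih₂ =>
    have e₁ := qPoch_succ q q r
    have e₂ := qPoch_succ q q s
    have e₃ := qPoch_succ q q (r + s + 1)
    rw [show r + (s + 1) = r + s + 1 by ring] at ih₁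
    rw [show r + 1 + s = r + s + 1 by ring] at ih₂
    rw [show r + 1 + (s + 1) = r + s + 1 + 1 by ring, e₃]
    calc _ = (1 - q * q ^ r) * (gaussPoly q r (s + 1) * (qPoch q q r * qPoch q q (s + 1)))
          + q ^ (r + 1) * (1 - q * q ^ s) *
            (gaussPoly q (r + 1) s * (qPoch q q (r + 1) * qPoch q q s)) := by
          rw [e₁, e₂]; ring
      _ = _ := by rw [ih₁, ih₂]; ring

theorem qBinom_eq_gaussPoly {F : Type*} [Field F] {q : F} (hq : ∀ r, qPoch q q r ≠ 0) (r s : ℕ) :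
    qBinom q ((s : ℤ) + r) r = gaussPoly q r s := by
  have h : (s : ℤ) + r - r = s := by ring
  have h' : ((s : ℤ) + r).toNat = r + s := by omega
  rw [qBinom, if_pos (by omega), h, h', Int.toNat_natCast, Int.toNat_natCast,
    div_eq_iff (mul_ne_zero (hq r) (hq s)), gaussPoly_mul_qPoch]

theorem le_mulVec_of_one_le_diag {n : ℕ} {K : Matrix (Fin n) (Fin n) ℕ} (hK : ∀ i, 1 ≤ K i i)
    (m : Fin n → ℕ) (i : Fin n) : m i ≤ K.mulVec m i :=
  calc m i ≤ K i i * m i := Nat.le_mul_of_pos_left _ (hK i)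
    _ ≤ _ := Finset.single_le_sum (f := fun j => K i j * m j) (fun _ _ => Nat.zero_le _)
      (Finset.mem_univ i)

/-- The term of index `m`, at `M = (t, …, t)`, of the identity defining a Durfee system,
after multiplication by `∏ i, (z i * q; q)_t`. -/
def durfeeTerm {F : Type*} [CommRing F] {n : ℕ} (K : Matrix (Fin n) (Fin n) ℕ)
    (Q a b : Fin n → ℕ) (q : F) (z : Fin n → F) (t : ℕ) (m : Fin n → ℕ) : F :=
  if ∀ i, K.mulVec m i + Q i + b i ≤ t then
    (∏ i, z i ^ (m i + a i)) * q ^ (∑ i, (m i + a i) * (K.mulVec m i + Q i + b i)) *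
      ∏ i, (qPoch q (z i * q * q ^ (K.mulVec m i + Q i)) (t - (K.mulVec m i + Q i)) *
        gaussPoly q (m i) (t - (K.mulVec m i + Q i + b i)))
  else 0

theorem map_durfeeTerm {F G : Type*} [CommRing F] [CommRing G] (φ : F →+* G) {n : ℕ}
    (K : Matrix (Fin n) (Fin n) ℕ) (Q a b : Fin n → ℕ) (q : F) (z : Fin n → F) (t : ℕ)
    (m : Fin n → ℕ) :
    φ (durfeeTerm K Q a b q z t m) = durfeeTerm K Q a b (φ q) (φ ∘ z) t m := by
  unfold durfeeTerm
  split_ifs <;> simp [map_prod, map_qPoch, map_gaussPoly]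

theorem qPoch_algebraMap_ne_zero {σ : Type*} (c : σ) (f : MvPolynomial σ ℚ)
    (hf : MvPolynomial.constantCoeff f = 0) (r : ℕ) :
    qPoch (algebraMap (MvPolynomial σ ℚ) (FractionRing (MvPolynomial σ ℚ)) (MvPolynomial.X c))
      (algebraMap (MvPolynomial σ ℚ) (FractionRing (MvPolynomial σ ℚ)) f) r ≠ 0 := by
  rw [← map_qPoch, Ne, map_eq_zero_iff _ (IsFractionRing.injective _ _)]
  intro h
  have := congrArg MvPolynomial.constantCoeff h
  rw [map_qPoch, hf] at this
  simp [qPoch] at this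

/-- A Durfee system yields an identity of polynomials, which can be specialized in any ring. -/
theorem IsDurfeeSystem.sum_durfeeTerm {F : Type*} [CommRing F] [Algebra ℚ F] {n L : ℕ}
    {K : Matrix (Fin n) (Fin n) ℕ} (hK : ∀ i, 1 ≤ K i i) {Q a b : Fin L → Fin n → ℕ}
    (hDur : IsDurfeeSystem K Q a b) (q : F) (z : Fin n → F) (t : ℕ) :
    ∑ k, ∑ m ∈ Fintype.piFinset fun _ => Finset.range (t + 1),
      durfeeTerm K (Q k) (a k) (b k) q z t m = 1 := by
  have key : ∑ k, ∑ m ∈ Fintype.piFinset fun _ => Finset.range (t + 1),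
      durfeeTerm K (Q k) (a k) (b k) (MvPolynomial.X none)
        (fun i => MvPolynomial.X (some i)) t m = (1 : MvPolynomial (Option (Fin n)) ℚ) := by
    apply IsFractionRing.injective (MvPolynomial (Option (Fin n)) ℚ) (FF n)
    have hq (r : ℕ) : qPoch (qv n) (qv n) r ≠ 0 := qPoch_algebraMap_ne_zero _ _ (by simp) r
    have hz (r : ℕ) (i : Fin n) : qPoch (qv n) (zv n i * qv n) r ≠ 0 := by
      rw [zv, qv, ← map_mul]
      exact qPoch_algebraMap_ne_zero _ _ (by simp) r
    have hP : (∏ i, qPoch (qv n) (zv n i * qv n) t) ≠ 0 :=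
      Finset.prod_ne_zero_iff.2 fun i _ => hz t i
    have h := congrArg (· * ∏ i, qPoch (qv n) (zv n i * qv n) t) (hDur fun _ => t).symm
    rw [inv_mul_cancel₀ hP, Finset.sum_mul] at h
    rw [map_one, ← h, map_sum]
    refine Finset.sum_congr rfl fun k _ => ?_
    rw [map_sum, finsum_eq_sum_of_support_subset
      (s := Fintype.piFinset fun _ => Finset.range (t + 1)), Finset.sum_mul]
    · refine Finset.sum_congr rfl fun m _ => ?_
      rw [map_durfeeTerm]
      change durfeeTerm K (Q k) (a k) (b k) (qv n) (zv n) t m = _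
      unfold durfeeTerm
      split_ifs with hm
      · rw [Finset.prod_mul_distrib]
        have hb (i : Fin n) : qBinom (qv n)
            ((t : ℤ) + m i - (K.mulVec m i + Q k i : ℕ) - b k i) (m i) =
            gaussPoly (qv n) (m i) (t - (K.mulVec m i + Q k i + b k i)) := by
          rw [← qBinom_eq_gaussPoly hq]
          congr 1
          have := hm i
          omega
        have hs (i : Fin n) : qPoch (qv n) (zv n i * qv n * qv n ^ (K.mulVec m i + Q k i))
            (t - (K.mulVec m i + Q k i)) =
            (qPoch (qv n) (zv n i * qv n) (K.mulVec m i + Q k i))⁻¹ *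
              qPoch (qv n) (zv n i * qv n) t := by
          rw [eq_inv_mul_iff_mul_eq₀ (hz _ i), ← qPoch_add]
          congr 1
          have := hm i
          omega
        simp only [hb, hs, Finset.prod_mul_distrib, Finset.prod_inv_distrib]
        ring
      · push Not at hm
        obtain ⟨i, hi⟩ := hm
        rw [Finset.prod_eq_zero (f := fun i => qBinom (qv n) _ _) (Finset.mem_univ i)]
        · simp
        · rw [qBinom, if_neg]
          omega
    · intro m hm
      rw [Finset.mem_coe, Fintype.mem_piFinset]
      intro i
      have hi := Finset.prod_ne_zero_iff.1 (right_ne_zero_of_mul hm) i (Finset.mem_univ i)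
      have := not_not.1 fun h0 => hi (if_neg h0)
      rw [Finset.mem_range]
      have := le_mulVec_of_one_le_diag hK m i
      omega
  have h := congrArg (MvPolynomial.aeval (R := ℚ) (fun o : Option (Fin n) => o.elim q z)) key
  rw [map_one, map_sum] at h
  rw [← h]
  refine Finset.sum_congr rfl fun k _ => ?_
  rw [map_sum]
  refine Finset.sum_congr rfl fun m _ => ?_
  have e := map_durfeeTerm
    (MvPolynomial.aeval (R := ℚ) (fun o : Option (Fin n) => o.elim q z)).toRingHom
    K (Q k) (a k) (b k) (MvPolynomial.X none) (fun i => MvPolynomial.X (some i)) t m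
  have e' : (⇑(MvPolynomial.aeval (R := ℚ) (fun o : Option (Fin n) => o.elim q z)).toRingHom ∘
      fun i => MvPolynomial.X (some i)) = z := by
    ext i; simp
  rw [e'] at e
  simpa using e.symm

open PowerSeries in
/-- The specialization `z i = X ^ p i` of `durfeeTerm`, as a power series. -/
def specializedTerm {n : ℕ} (K : Matrix (Fin n) (Fin n) ℕ) (Q a b : Fin n → ℕ) (p : Fin n → ℤ)
    (t : ℕ) (m : Fin n → ℕ) : PowerSeries ℤ :=
  if ∀ i, K.mulVec m i + Q i + b i ≤ t ∧ 0 ≤ ((K.mulVec m i + Q i : ℕ) : ℤ) + p i then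
    X ^ (∑ i, (m i + a i) * ((((K.mulVec m i + Q i : ℕ) : ℤ) + p i).toNat + b i)) *
      ∏ i, (qPoch X (X * X ^ (((K.mulVec m i + Q i : ℕ) : ℤ) + p i).toNat)
          (t - (K.mulVec m i + Q i)) *
        gaussPoly X (m i) (t - (K.mulVec m i + Q i + b i)))
  else 0

theorem map_specializedTerm {F : Type*} [Field F] (ψ : PowerSeries ℤ →+* F)
    (hψ : ψ PowerSeries.X ≠ 0) {n : ℕ} (K : Matrix (Fin n) (Fin n) ℕ) (Q a b : Fin n → ℕ)
    {p : Fin n → ℤ} {t : ℕ} (ht : ∀ i, 0 ≤ (t : ℤ) + p i) (m : Fin n → ℕ) :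
    ψ (specializedTerm K Q a b p t m) =
      durfeeTerm K Q a b (ψ PowerSeries.X) (fun i => ψ PowerSeries.X ^ p i) t m := by
  set x := ψ PowerSeries.X
  unfold specializedTerm durfeeTerm
  by_cases hm : ∀ i, K.mulVec m i + Q i + b i ≤ t
  · rw [if_pos hm]
    by_cases hp : ∀ i, 0 ≤ ((K.mulVec m i + Q i : ℕ) : ℤ) + p i
    · have hx (i : Fin n) : x ^ p i * x ^ (K.mulVec m i + Q i) =
          x ^ (((K.mulVec m i + Q i : ℕ) : ℤ) + p i).toNat := by
        rw [← zpow_natCast x, ← zpow_natCast x, ← zpow_add₀ hψ, Int.toNat_of_nonneg (hp i),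
          add_comm]
      rw [if_pos fun i => ⟨hm i, hp i⟩, map_mul, map_pow, map_prod]
      congr 1
      · rw [← Finset.prod_pow_eq_pow_sum, ← Finset.prod_pow_eq_pow_sum, ← Finset.prod_mul_distrib]
        refine Finset.prod_congr rfl fun i _ => ?_
        have hb : x ^ p i * x ^ (K.mulVec m i + Q i + b i) =
            x ^ ((((K.mulVec m i + Q i : ℕ) : ℤ) + p i).toNat + b i) := by
          rw [pow_add, ← mul_assoc, hx, ← pow_add]
        rw [mul_comm (m i + a i), mul_comm (m i + a i), pow_mul, pow_mul, ← mul_pow, hb]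
      · refine Finset.prod_congr rfl fun i _ => ?_
        rw [map_mul, map_qPoch, map_gaussPoly, map_mul, map_pow, ← hx]
        congr 2
        ring
    · rw [if_neg fun h => hp fun i => (h i).2, map_zero]
      push Not at hp
      obtain ⟨i, hi⟩ := hp
      refine (mul_eq_zero_of_right _ (Finset.prod_eq_zero (Finset.mem_univ i) ?_)).symm
      rw [qPoch, Finset.prod_eq_zero
        (i := (-(((K.mulVec m i + Q i : ℕ) : ℤ) + p i) - 1).toNat), zero_mul]
      · have := ht i
        have := hm i
        rw [Finset.mem_range]
        omega
      · rw [← zpow_natCast x, ← zpow_natCast x, ← zpow_add_one₀ hψ, ← zpow_add₀ hψ,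
          ← zpow_add₀ hψ, sub_eq_zero, eq_comm, ← zpow_zero x]
        congr 1
        omega
  · rw [if_neg hm, if_neg fun h => hm fun i => (h i).1, map_zero]

theorem IsDurfeeSystem.sum_specializedTerm {n L : ℕ} {K : Matrix (Fin n) (Fin n) ℕ}
    (hK : ∀ i, 1 ≤ K i i) {Q a b : Fin L → Fin n → ℕ} (hDur : IsDurfeeSystem K Q a b)
    {p : Fin n → ℤ} {t : ℕ} (ht : ∀ i, 0 ≤ (t : ℤ) + p i) :
    ∑ k, ∑ m ∈ Fintype.piFinset fun _ => Finset.range (t + 1),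
      specializedTerm K (Q k) (a k) (b k) p t m = 1 := by
  let ψ : PowerSeries ℤ →+* LaurentSeries ℚ :=
    (HahnSeries.ofPowerSeries ℤ ℚ).comp (PowerSeries.map (Int.castRingHom ℚ))
  have hψ : Function.Injective ψ := by
    rw [RingHom.coe_comp]
    exact HahnSeries.ofPowerSeries_injective.comp
      (PowerSeries.map_injective _ (RingHom.injective_int _))
  have hX : ψ PowerSeries.X ≠ 0 := (map_ne_zero_iff ψ hψ).2 PowerSeries.X_ne_zero
  apply hψ
  simp only [map_sum, map_one, map_specializedTerm ψ hX _ _ _ _ ht]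
  exact hDur.sum_durfeeTerm hK _ _ t

theorem le_of_exponent_le {n : ℕ} {K : Matrix (Fin n) (Fin n) ℕ} (hK : ∀ i, 1 ≤ K i i)
    {Q a b : Fin n → ℕ} {p : Fin n → ℤ} {m : Fin n → ℕ} {d : ℕ}
    (hd : ∑ i, (m i + a i) * ((((K.mulVec m i + Q i : ℕ) : ℤ) + p i).toNat + b i) ≤ d)
    (i : Fin n) : m i ≤ d + (p i).natAbs := by
  by_contra! hi
  have h₁ := (Finset.single_le_sum
    (f := fun i => (m i + a i) * ((((K.mulVec m i + Q i : ℕ) : ℤ) + p i).toNat + b i))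
    (fun _ _ => Nat.zero_le _) (Finset.mem_univ i)).trans hd
  have h₂ := le_mulVec_of_one_le_diag hK m i
  have h₃ : 1 * (d + 1) ≤
      (m i + a i) * ((((K.mulVec m i + Q i : ℕ) : ℤ) + p i).toNat + b i) :=
    Nat.mul_le_mul (by omega) (by omega)
  omega

section Limit

open PowerSeries Filter Topology

instance : IsTopologicalRing (PowerSeries ℤ) := PowerSeries.WithPiTopology.instIsTopologicalRing ℤ

instance : T2Space (PowerSeries ℤ) := PowerSeries.WithPiTopology.instT2Space ℤ

theorem tendsto_iff_forall_coeff {ι : Type*} {f : ι → PowerSeries ℤ} {u : Filter ι}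
    {g : PowerSeries ℤ} :
    Tendsto f u (𝓝 g) ↔ ∀ d, Tendsto (fun i => coeff d (f i)) u (𝓝 (coeff d g)) :=
  PowerSeries.WithPiTopology.tendsto_iff_coeff_tendsto ℤ f u g

theorem hasSum_iff_forall_coeff {ι : Type*} {f : ι → PowerSeries ℤ} {g : PowerSeries ℤ} :
    HasSum f g ↔ ∀ d, HasSum (fun i => coeff d (f i)) (coeff d g) :=
  PowerSeries.WithPiTopology.hasSum_iff_hasSum_coeff ℤ

theorem tendsto_X_pow : Tendsto (fun t => (X : PowerSeries ℤ) ^ t) atTop (𝓝 0) :=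
  PowerSeries.WithPiTopology.isTopologicallyNilpotent_of_constantCoeff_zero (by simp)

theorem tendsto_qPoch_X :
    Tendsto (qPoch (X : PowerSeries ℤ) X) atTop (𝓝 (∏' j : ℕ, (1 - X ^ (j + 1)))) := by
  have h : Multipliable fun j : ℕ => (1 - X ^ (j + 1) : PowerSeries ℤ) :=
    PowerSeries.WithPiTopology.multipliable_one_sub_X_pow ℤ
  refine h.hasProd.tendsto_prod_nat.congr fun t => ?_
  simp only [qPoch, pow_succ']

theorem constantCoeff_qPoch_X (r : ℕ) : constantCoeff (qPoch (X : PowerSeries ℤ) X r) = 1 := by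
  simp [qPoch]

theorem isUnit_qPoch_X (r : ℕ) : IsUnit (qPoch (X : PowerSeries ℤ) X r) := by
  rw [isUnit_iff_constantCoeff, constantCoeff_qPoch_X]
  exact isUnit_one

theorem isUnit_tprod_one_sub_X_pow : IsUnit (∏' j : ℕ, (1 - (X : PowerSeries ℤ) ^ (j + 1))) := by
  have h := tendsto_iff_forall_coeff.1 tendsto_qPoch_X 0
  simp only [coeff_zero_eq_constantCoeff_apply, constantCoeff_qPoch_X] at h
  rw [isUnit_iff_constantCoeff, ← tendsto_nhds_unique tendsto_const_nhds h]
  exact isUnit_one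

theorem gaussPoly_mul_qPoch_left (r s : ℕ) :
    gaussPoly X r s * qPoch (X : PowerSeries ℤ) X r = qPoch X (X * X ^ s) r := by
  apply (isUnit_qPoch_X s).mul_left_cancel
  rw [← qPoch_add, add_comm s, ← gaussPoly_mul_qPoch]
  ring

theorem tendsto_gaussPoly (r : ℕ) : Tendsto (fun s => gaussPoly (X : PowerSeries ℤ) r s) atTop
    (𝓝 (Ring.inverse (qPoch X X r))) := by
  have h : Tendsto (fun s => qPoch (X : PowerSeries ℤ) (X * X ^ s) r) atTop (𝓝 1) := by
    have : Tendsto (fun s => ∏ k ∈ Finset.range r, (1 - (X : PowerSeries ℤ) * X ^ s * X ^ k)) atTop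
        (𝓝 (∏ k ∈ Finset.range r, (1 - X * 0 * X ^ k))) :=
      tendsto_finsetProd _ fun k _ =>
        tendsto_const_nhds.sub ((tendsto_X_pow.const_mul _).mul_const _)
    simpa [qPoch] using this
  have h' := h.mul_const (Ring.inverse (qPoch X X r))
  rw [one_mul] at h'
  refine h'.congr fun s => ?_
  rw [← gaussPoly_mul_qPoch_left, Ring.mul_inverse_cancel_right _ _ (isUnit_qPoch_X r)]

theorem tendsto_qPoch_mul_X_pow (r : ℕ) :
    Tendsto (fun s => qPoch (X : PowerSeries ℤ) (X * X ^ r) s) atTop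
      (𝓝 ((∏' j : ℕ, (1 - X ^ (j + 1))) * Ring.inverse (qPoch X X r))) := by
  have h := ((tendsto_add_atTop_iff_nat r).2 tendsto_qPoch_X).mul_const
    (Ring.inverse (qPoch (X : PowerSeries ℤ) X r))
  refine h.congr fun s => ?_
  rw [add_comm s, qPoch_add, mul_comm (qPoch X X r),
    Ring.mul_inverse_cancel_right _ _ (isUnit_qPoch_X r)]

/-- The limit of `specializedTerm` as `t` tends to infinity. -/
def limitTerm {n : ℕ} (K : Matrix (Fin n) (Fin n) ℕ) (Q a b : Fin n → ℕ) (p : Fin n → ℤ)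
    (m : Fin n → ℕ) : PowerSeries ℤ :=
  if ∀ i, 0 ≤ ((K.mulVec m i + Q i : ℕ) : ℤ) + p i then
    X ^ (∑ i, (m i + a i) * ((((K.mulVec m i + Q i : ℕ) : ℤ) + p i).toNat + b i)) *
      ∏ i, ((∏' j : ℕ, (1 - X ^ (j + 1))) *
        Ring.inverse (qPoch X X (((K.mulVec m i + Q i : ℕ) : ℤ) + p i).toNat) *
        Ring.inverse (qPoch X X (m i)))
  else 0

theorem tendsto_specializedTerm {n : ℕ} (K : Matrix (Fin n) (Fin n) ℕ) (Q a b : Fin n → ℕ)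
    (p : Fin n → ℤ) (m : Fin n → ℕ) :
    Tendsto (fun t => specializedTerm K Q a b p t m) atTop (𝓝 (limitTerm K Q a b p m)) := by
  unfold limitTerm
  split_ifs with hp
  · refine Tendsto.congr' ?_ (tendsto_const_nhds.mul (tendsto_finsetProd _ fun i _ =>
      ((tendsto_qPoch_mul_X_pow _).comp (tendsto_sub_atTop_nat (K.mulVec m i + Q i))).mul
        ((tendsto_gaussPoly (m i)).comp (tendsto_sub_atTop_nat (K.mulVec m i + Q i + b i)))))
    filter_upwards [eventually_all.2 fun i => eventually_ge_atTop (K.mulVec m i + Q i + b i)]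
      with t ht
    rw [specializedTerm, if_pos fun i => ⟨ht i, hp i⟩]
    rfl
  · refine tendsto_const_nhds.congr fun t => ?_
    rw [specializedTerm, if_neg fun h => hp fun i => (h i).2]

theorem coeff_specializedTerm_eq_zero {n : ℕ} {K : Matrix (Fin n) (Fin n) ℕ}
    (hK : ∀ i, 1 ≤ K i i) {Q a b : Fin n → ℕ} {p : Fin n → ℤ} {t : ℕ} {m : Fin n → ℕ} {d : ℕ}
    (hm : m ∉ Fintype.piFinset fun i => Finset.range (d + (p i).natAbs + 1)) :
    coeff d (specializedTerm K Q a b p t m) = 0 := by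
  unfold specializedTerm
  split_ifs
  · rw [coeff_X_pow_mul', if_neg]
    refine fun hd => hm (Fintype.mem_piFinset.2 fun i => ?_)
    have := le_of_exponent_le hK hd i
    rw [Finset.mem_range]
    omega
  · simp

theorem coeff_limitTerm_eq_zero {n : ℕ} {K : Matrix (Fin n) (Fin n) ℕ}
    (hK : ∀ i, 1 ≤ K i i) {Q a b : Fin n → ℕ} {p : Fin n → ℤ} {m : Fin n → ℕ} {d : ℕ}
    (hm : m ∉ Fintype.piFinset fun i => Finset.range (d + (p i).natAbs + 1)) :
    coeff d (limitTerm K Q a b p m) = 0 :=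
  tendsto_nhds_unique (tendsto_iff_forall_coeff.1 (tendsto_specializedTerm K Q a b p m) d)
    (tendsto_const_nhds.congr fun _ => (coeff_specializedTerm_eq_zero hK hm).symm)

theorem summable_limitTerm {n : ℕ} {K : Matrix (Fin n) (Fin n) ℕ}
    (hK : ∀ i, 1 ≤ K i i) (Q a b : Fin n → ℕ) (p : Fin n → ℤ) :
    Summable (limitTerm K Q a b p) := by
  refine ⟨PowerSeries.mk fun d => ∑ m ∈ Fintype.piFinset fun i =>
    Finset.range (d + (p i).natAbs + 1), coeff d (limitTerm K Q a b p m),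
    hasSum_iff_forall_coeff.2 fun d => ?_⟩
  rw [coeff_mk]
  exact hasSum_sum_of_ne_finset_zero fun m hm => coeff_limitTerm_eq_zero hK hm

theorem IsDurfeeSystem.sum_tsum_limitTerm {n L : ℕ} {K : Matrix (Fin n) (Fin n) ℕ}
    (hK : ∀ i, 1 ≤ K i i) {Q a b : Fin L → Fin n → ℕ} (hDur : IsDurfeeSystem K Q a b)
    (p : Fin n → ℤ) : ∑ k, ∑' m, limitTerm K (Q k) (a k) (b k) p m = 1 := by
  ext d
  set B := Fintype.piFinset fun i => Finset.range (d + (p i).natAbs + 1)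
  have h₁ (k : Fin L) : coeff d (∑' m, limitTerm K (Q k) (a k) (b k) p m) =
      ∑ m ∈ B, coeff d (limitTerm K (Q k) (a k) (b k) p m) :=
    (hasSum_iff_forall_coeff.1 (summable_limitTerm hK _ _ _ p).hasSum d).unique
      (hasSum_sum_of_ne_finset_zero fun m hm => coeff_limitTerm_eq_zero hK hm)
  have h₂ : Tendsto
      (fun t => ∑ k, ∑ m ∈ B, coeff d (specializedTerm K (Q k) (a k) (b k) p t m)) atTop
      (𝓝 (∑ k, ∑ m ∈ B, coeff d (limitTerm K (Q k) (a k) (b k) p m))) :=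
    tendsto_finsetSum _ fun k _ => tendsto_finsetSum _ fun m _ =>
      tendsto_iff_forall_coeff.1 (tendsto_specializedTerm _ _ _ _ _ _) d
  rw [map_sum, Finset.sum_congr rfl fun k _ => h₁ k]
  refine tendsto_nhds_unique h₂ (tendsto_const_nhds.congr' ?_)
  filter_upwards [eventually_all.2 fun i => eventually_ge_atTop (d + (p i).natAbs)] with t ht
  rw [← hDur.sum_specializedTerm hK (p := p) (t := t) fun i => by have := ht i; omega, map_sum]
  refine Finset.sum_congr rfl fun k _ => ?_
  rw [map_sum]
  have hB : B ⊆ Fintype.piFinset fun _ => Finset.range (t + 1) :=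
    Fintype.piFinset_subset _ _ fun i => Finset.range_subset_range.2 (Nat.succ_le_succ (ht i))
  symm
  exact Finset.sum_subset hB fun m _ hm => coeff_specializedTerm_eq_zero hK hm

theorem tsum_durfee_eq_mul_tsum_limitTerm {n : ℕ} (K : Matrix (Fin n) (Fin n) ℕ)
    (hK : ∀ i, 1 ≤ K i i) (Q a b : Fin n → ℕ) (p : Fin n → ℤ) :
    (∑' mN : (Fin n → ℕ) × (Fin n → ℕ),
      if ∀ i, (mN.2 i : ℤ) - (K.mulVec mN.1 i : ℕ) = (Q i : ℤ) + p i then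
        (X : PowerSeries ℤ) ^ (∑ i, (mN.1 i + a i) * (mN.2 i + b i)) *
          Ring.inverse (∏ i, qPoch X X (mN.1 i) * qPoch X X (mN.2 i))
      else 0) =
    (Ring.inverse (∏' j : ℕ, (1 - X ^ (j + 1)))) ^ n * ∑' m, limitTerm K Q a b p m := by
  let g (m : Fin n → ℕ) : (Fin n → ℕ) × (Fin n → ℕ) :=
    (m, fun i => (((K.mulVec m i + Q i : ℕ) : ℤ) + p i).toNat)
  have hg : Function.Injective g := fun m m' h => congrArg Prod.fst h
  rw [← (summable_limitTerm hK Q a b p).tsum_mul_left, ← hg.tsum_eq]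
  · refine tsum_congr fun m => ?_
    unfold limitTerm
    by_cases hm : ∀ i, 0 ≤ ((K.mulVec m i + Q i : ℕ) : ℤ) + p i
    · rw [if_pos hm, if_pos fun i => by have := hm i; simp only [g]; omega]
      have hinv (r s : ℕ) : Ring.inverse (qPoch (X : PowerSeries ℤ) X r * qPoch X X s) =
          Ring.inverse (∏' j : ℕ, (1 - X ^ (j + 1))) * ((∏' j : ℕ, (1 - X ^ (j + 1))) *
            Ring.inverse (qPoch X X s) * Ring.inverse (qPoch X X r)) := by
        rw [Ring.mul_inverse_rev, mul_assoc,
          Ring.inverse_mul_cancel_left _ _ isUnit_tprod_one_sub_X_pow]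
      rw [← MonoidWithZero.coe_inverse, map_prod, MonoidWithZero.coe_inverse]
      simp only [hinv]
      rw [Finset.prod_mul_distrib, Finset.prod_const, Finset.card_univ, Fintype.card_fin,
        mul_left_comm]
    · rw [if_neg hm, mul_zero, if_neg]
      contrapose! hm
      intro i
      have := hm i
      simp only [g] at this
      omega
  · intro mN h
    have hN := not_not.1 fun h0 => h (if_neg h0)
    refine ⟨mN.1, Prod.ext rfl (funext fun i => ?_)⟩
    have := hN i
    simp only [g]
    omega

end Limit

/-- If `(Q k, a k, b k)` is a Durfee system for an invertible
symmetric positive-definite `K ∈ GL(n, ℤ≥0)`, then for every `p ∈ ℤ^n`, in `ℤ[[q]]`: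
`(∏_{j≥1}(1 - q^j))^(-n)
  = Σ_k Σ_{(m, N̄) : N̄ - K·m = Q k + p} q^{(m+a)·(N̄+b)} / ∏_i (q;q)_{m_i} (q;q)_{N̄_i}`,
where the inner `tsum` runs over pairs `m, N̄ ∈ (ℤ≥0)^n` satisfying the constraint
(positive definiteness of `K` guarantees that only finitely many terms contribute to
each power of `q`); the infinite product is a coefficient-wise convergent `tprod`, with
constant coefficient `1`, and is inverted as a unit via `Ring.inverse`, as are the
finite Pochhammer products on the right. -/
theorem durfee_character_identity {n L : ℕ} (K : Matrix (Fin n) (Fin n) ℕ)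
    (hsym : K.IsSymm) (hpd : (K.map (Nat.cast : ℕ → ℚ)).PosDef)
    (Q a b : Fin L → Fin n → ℕ) (hDur : IsDurfeeSystem K Q a b) (p : Fin n → ℤ) :
    (Ring.inverse (∏' j : ℕ, (1 - (PowerSeries.X : PowerSeries ℤ) ^ (j + 1)))) ^ n =
      ∑ k : Fin L, ∑' mN : (Fin n → ℕ) × (Fin n → ℕ),
        if ∀ i, (mN.2 i : ℤ) - (K.mulVec mN.1 i : ℕ) = (Q k i : ℤ) + p i then
          (PowerSeries.X : PowerSeries ℤ) ^
              (∑ i, (mN.1 i + a k i) * (mN.2 i + b k i)) *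
            Ring.inverse (∏ i,
              qPoch (PowerSeries.X : PowerSeries ℤ) PowerSeries.X (mN.1 i) *
              qPoch (PowerSeries.X : PowerSeries ℤ) PowerSeries.X (mN.2 i))
        else 0 := by
  have hK (i : Fin n) : 1 ≤ K i i := by
    have h := hpd.diag_pos (i := i)
    rw [Matrix.map_apply] at h
    exact_mod_cast h
  simp only [tsum_durfee_eq_mul_tsum_limitTerm K hK]
  rw [← Finset.mul_sum, hDur.sum_tsum_limitTerm hK, mul_one]
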